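/- There exists a constant A > 0 such that for s = σ + it with 1 − A/log|t| ≤ σ ≤ 2 and |t| ≥ 2: ζ(s) ≠ 0 and |ζ'(s)/ζ(s)| ≤ C log|t| for an absolute constant C. -/

import Mathlib

open Real

open Complex MeasureTheory Set Filter Topology in
lemma mellin_fract_eq (s : ℂ) :
    mellin (indicator (Ioi (1 : ℝ)) fun x ↦ ((Int.fract x : ℝ) : ℂ)) (-s) =
      ∫ x in Ioi (1 : ℝ), ((Int.fract x : ℝ) : ℂ) * (x : ℂ) ^ (-(s + 1)) := by
  rw [mellin]
  have : ∀ x : ℝ, (x : ℂ) ^ (-s - 1) • (indicator (Ioi (1 : ℝ)) (fun x ↦ ((Int.fract x : ℝ) : ℂ)) x)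
      = indicator (Ioi (1 : ℝ)) (fun x ↦ ((Int.fract x : ℝ) : ℂ) * (x : ℂ) ^ (-(s + 1))) x := by
    intro x
    by_cases hx : x ∈ Ioi (1 : ℝ)
    · rw [indicator_of_mem hx, indicator_of_mem hx, smul_eq_mul, mul_comm, neg_add']
    · rw [indicator_of_notMem hx, indicator_of_notMem hx, smul_zero]
  simp_rw [this]
  rw [setIntegral_indicator measurableSet_Ioi, inter_eq_self_of_subset_right]
  exact Ioi_subset_Ioi zero_le_one

open Complex MeasureTheory Set Filter Topology in
lemma integrableOn_fract_mul_cpow {s : ℂ} (hs : 0 < s.re) :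
    IntegrableOn (fun x : ℝ ↦ ((Int.fract x : ℝ) : ℂ) * (x : ℂ) ^ (-(s + 1))) (Ioi 1) := by
  refine Integrable.bdd_mul (c := 1) (integrableOn_Ioi_cpow_of_lt ?_ one_pos) ?_ ?_
  · simpa using hs
  · exact (measurable_ofReal.comp measurable_fract).aestronglyMeasurable
  · refine Eventually.of_forall fun x ↦ ?_
    rw [norm_real, Real.norm_eq_abs, abs_of_nonneg (Int.fract_nonneg x)]
    exact (Int.fract_lt_one x).le

open Complex MeasureTheory Set Filter Topology in
lemma norm_integral_fract_mul_cpow_le {s : ℂ} (hs : 0 < s.re) :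
    ‖∫ x in Ioi (1 : ℝ), ((Int.fract x : ℝ) : ℂ) * (x : ℂ) ^ (-(s + 1))‖ ≤ 1 / s.re := by
  have h1 : ∫ x in Ioi (1 : ℝ), x ^ (-(s.re + 1)) = 1 / s.re := by
    rw [integral_Ioi_rpow_of_lt (by linarith) one_pos]
    simp
  rw [← h1]
  refine norm_integral_le_of_norm_le (integrableOn_Ioi_rpow_of_lt (by linarith) one_pos) ?_
  refine (ae_restrict_iff' measurableSet_Ioi).mpr (Eventually.of_forall fun x hx ↦ ?_)
  have hx0 : 0 < x := one_pos.trans hx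
  rw [norm_mul, norm_cpow_eq_rpow_re_of_pos hx0, norm_real, Real.norm_eq_abs,
    abs_of_nonneg (Int.fract_nonneg x)]
  simp only [neg_re, add_re, one_re]
  exact mul_le_of_le_one_left (Real.rpow_nonneg hx0.le _) (Int.fract_lt_one x).le

open Complex MeasureTheory Set Filter Topology in
lemma differentiableAt_integral_fract_mul_cpow {s : ℂ} (hs : 0 < s.re) :
    DifferentiableAt ℂ
      (fun s : ℂ ↦ ∫ x in Ioi (1 : ℝ), ((Int.fract x : ℝ) : ℂ) * (x : ℂ) ^ (-(s + 1))) s := by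
  simp_rw [← mellin_fract_eq]
  refine DifferentiableAt.fun_comp' (f := fun s : ℂ ↦ -s) s ?_ (by fun_prop)
  refine mellin_differentiableAt_of_isBigO_rpow (a := 0) (b := -s.re - 1) ?_ ?_ (by simpa) ?_
    (by simp)
  · refine LocallyIntegrable.locallyIntegrableOn ?_ _
    refine (locallyIntegrable_const (1 : ℝ)).mono ?_ (Eventually.of_forall fun x ↦ ?_)
    · exact ((measurable_ofReal.comp measurable_fract).indicator
        measurableSet_Ioi).aestronglyMeasurable
    · refine (norm_indicator_le_norm_self _ _).trans ?_
      rw [norm_real, norm_one, Real.norm_eq_abs, abs_of_nonneg (Int.fract_nonneg x)]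
      exact (Int.fract_lt_one x).le
  · refine Asymptotics.IsBigO.of_bound 1 (Eventually.of_forall fun x ↦ ?_)
    refine (norm_indicator_le_norm_self _ _).trans ?_
    simpa [abs_of_nonneg (Int.fract_nonneg x)] using (Int.fract_lt_one x).le
  · refine (Asymptotics.isBigO_zero _ _).congr' ?_ EventuallyEq.rfl
    filter_upwards [Ioo_mem_nhdsGT (zero_lt_one (α := ℝ))] with x hx
    rw [indicator_of_notMem]
    simpa using hx.2.le

open Complex MeasureTheory Set Filter Topology in
lemma riemannZeta_eq_integral_fract {s : ℂ} (hs : 1 < s.re) :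
    riemannZeta s = s / (s - 1) -
      s * ∫ x in Ioi (1 : ℝ), ((Int.fract x : ℝ) : ℂ) * (x : ℂ) ^ (-(s + 1)) := by
  have hs1 : s - 1 ≠ 0 := sub_ne_zero.mpr fun h ↦ by simp [h] at hs
  have hint : ∫ x in Ioi (1 : ℝ), (x : ℂ) ^ (-s) = 1 / (s - 1) := by
    rw [integral_Ioi_cpow_of_lt (by simpa using hs) one_pos]
    rw [ofReal_one, one_cpow, show -s + 1 = -(s - 1) by ring, div_neg, neg_div, neg_neg]
  rw [← LSeries_one_eq_riemannZeta hs, LSeries_eq_mul_integral _ zero_le_one hs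
    (LSeriesSummable_one_iff.mpr hs), div_eq_mul_one_div, ← mul_sub, ← hint, ← integral_sub
      (integrableOn_Ioi_cpow_of_lt (by simpa using hs) one_pos)
      (integrableOn_fract_mul_cpow (by linarith))]
  · congr 1
    refine setIntegral_congr_fun measurableSet_Ioi fun x hx ↦ ?_
    have hx0 : 0 < x := one_pos.trans hx
    have hx' : (x : ℂ) ≠ 0 := ofReal_ne_zero.mpr hx0.ne'
    have h2 : ((⌊x⌋₊ : ℝ) : ℂ) = x - ((Int.fract x : ℝ) : ℂ) := by
      rw [natCast_floor_eq_intCast_floor hx0.le, ← ofReal_sub, Int.self_sub_fract]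
    have h3 : (x : ℂ) ^ (-s) = x * (x : ℂ) ^ (-(s + 1)) := by
      rw [show -s = 1 + -(s + 1) by ring, cpow_add _ _ hx', cpow_one]
    simp only [Pi.one_apply, Finset.sum_const, Nat.card_Icc, Nat.add_sub_cancel, nsmul_eq_mul,
      mul_one]
    rw [h3, ← sub_mul, ← h2, ofReal_natCast]
  · refine Asymptotics.IsBigO.of_bound 1 (Eventually.of_forall fun n ↦ ?_)
    simp

open Complex MeasureTheory Set Filter Topology in
lemma riemannZeta₁_eq_integral_fract {s : ℂ} (hs : 0 < s.re) :
    riemannZeta₁ s = s - s * (s - 1) *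
      ∫ x in Ioi (1 : ℝ), ((Int.fract x : ℝ) : ℂ) * (x : ℂ) ^ (-(s + 1)) := by
  have hU : IsOpen {z : ℂ | 0 < z.re} := isOpen_lt continuous_const continuous_re
  have hc : IsPreconnected {z : ℂ | 0 < z.re} := (convex_halfSpace_re_gt 0).isPreconnected
  refine AnalyticOnNhd.eqOn_of_preconnected_of_eventuallyEq (𝕜 := ℂ)
    (g := fun s ↦ s - s * (s - 1) *
      ∫ x in Ioi (1 : ℝ), ((Int.fract x : ℝ) : ℂ) * (x : ℂ) ^ (-(s + 1)))
    (differentiable_riemannZeta₁.differentiableOn.analyticOnNhd hU)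
    (DifferentiableOn.analyticOnNhd (fun z hz ↦ ?_) hU) hc (z₀ := 2) (by simp) ?_ hs
  · have := differentiableAt_integral_fract_mul_cpow hz
    exact DifferentiableAt.differentiableWithinAt (by fun_prop)
  · filter_upwards [(isOpen_lt continuous_const continuous_re).mem_nhds
      (show (2 : ℂ) ∈ {z : ℂ | 1 < z.re} by simp)] with z hz
    have hz1 : z - 1 ≠ 0 := sub_ne_zero.mpr fun h ↦ by simp [h] at hz
    have h1 := riemannZeta_eq_inv_sub_mul (sub_ne_zero.mp hz1)
    rw [riemannZeta_eq_integral_fract hz, eq_inv_mul_iff_mul_eq₀ hz1] at h1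
    rw [← h1]
    field_simp

/-- The entire function `(s - 1) ζ(s)` grows at most quadratically in `0 < Re s`. -/
lemma norm_riemannZeta₁_le {s : ℂ} (hs : 0 < s.re) :
    ‖riemannZeta₁ s‖ ≤ ‖s‖ + ‖s‖ * ‖s - 1‖ / s.re := by
  rw [riemannZeta₁_eq_integral_fract hs]
  refine (norm_sub_le _ _).trans ?_
  rw [norm_mul, norm_mul, div_eq_mul_one_div]
  gcongr
  exact norm_integral_fract_mul_cpow_le hs

lemma Complex.exists_multiset_prod_mul_of_bound {f : ℂ → ℂ} (hf : Differentiable ℂ f) {c : ℂ} {M : ℝ}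
    (hc : f c ≠ 0) (hM : ∀ z ∈ Metric.closedBall c 1, ‖f z‖ ≤ M) :
    ∃ (Z : Multiset ℂ) (g : ℂ → ℂ), Differentiable ℂ g ∧
      (∀ z, f z = (Z.map fun ρ ↦ z - ρ).prod * g z) ∧
      (∀ ρ ∈ Z, ρ ∈ Metric.closedBall c (1 / 3)) ∧
      (∀ z ∈ Metric.closedBall c (1 / 3), g z ≠ 0) ∧
      (∀ z ∈ Metric.closedBall c 1, ‖g z‖ ≤ M / ‖f c‖ * ‖g c‖) := by
  have hfc : 0 < ‖f c‖ := norm_pos_iff.mpr hc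
  -- a factorisation with `n` zeros in the small ball
  let P : ℕ → Prop := fun n ↦ ∃ (Z : Multiset ℂ) (g : ℂ → ℂ), Z.card = n ∧ Differentiable ℂ g ∧
      (∀ z, f z = (Z.map fun ρ ↦ z - ρ).prod * g z) ∧
      (∀ ρ ∈ Z, ρ ∈ Metric.closedBall c (1 / 3))
  have hprod : ∀ (Z : Multiset ℂ), (∀ ρ ∈ Z, ρ ∈ Metric.closedBall c (1 / 3)) →
      ∀ z ∈ Metric.sphere c 1,
      2 ^ Z.card * ‖(Z.map fun ρ ↦ c - ρ).prod‖ ≤ ‖(Z.map fun ρ ↦ z - ρ).prod‖ := by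
    intro Z
    induction Z using Multiset.induction_on with
    | empty => simp
    | cons a Z ih =>
      intro h z hz
      have h1 := ih (fun ρ hρ ↦ h ρ (Multiset.mem_cons_of_mem hρ)) z hz
      have h2 := h a (Multiset.mem_cons_self a Z)
      rw [Multiset.map_cons, Multiset.map_cons, Multiset.prod_cons, Multiset.prod_cons, norm_mul,
        norm_mul, Multiset.card_cons, pow_succ]
      have h3 : 2 * ‖c - a‖ ≤ ‖z - a‖ := by
        rw [Metric.mem_closedBall, dist_comm, dist_eq_norm] at h2
        rw [Metric.mem_sphere, dist_eq_norm] at hz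
        have := norm_sub_norm_le (z - c) (a - c)
        rw [sub_sub_sub_cancel_right, hz, norm_sub_rev a c] at this
        linarith
      calc _ = (2 * ‖c - a‖) * (2 ^ Z.card * ‖(Z.map fun ρ ↦ c - ρ).prod‖) := by ring
        _ ≤ _ := by gcongr
  have hbound : ∀ (Z : Multiset ℂ) (g : ℂ → ℂ), Differentiable ℂ g →
      (∀ z, f z = (Z.map fun ρ ↦ z - ρ).prod * g z) →
      (∀ ρ ∈ Z, ρ ∈ Metric.closedBall c (1 / 3)) →
      ∀ z ∈ Metric.closedBall c 1, 2 ^ Z.card * ‖g z‖ ≤ M / ‖f c‖ * ‖g c‖ := by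
    intro Z g hg hfg hZ z hz
    rw [← le_div_iff₀' (by positivity)]
    refine Complex.norm_le_of_forall_mem_frontier_norm_le (U := Metric.ball c 1)
      Metric.isBounded_ball hg.diffContOnCl ?_ ?_
    · intro w hw
      rw [frontier_ball c one_ne_zero] at hw
      rw [le_div_iff₀' (by positivity), div_mul_eq_mul_div, le_div_iff₀ hfc]
      have h1 := hM w (Metric.sphere_subset_closedBall hw)
      calc 2 ^ Z.card * ‖g w‖ * ‖f c‖
          = (2 ^ Z.card * ‖(Z.map fun ρ ↦ c - ρ).prod‖) * ‖g w‖ * ‖g c‖ := by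
            rw [hfg c, norm_mul]; ring
        _ ≤ ‖(Z.map fun ρ ↦ w - ρ).prod‖ * ‖g w‖ * ‖g c‖ := by gcongr; exact hprod Z hZ w hw
        _ = ‖f w‖ * ‖g c‖ := by rw [hfg w, norm_mul]
        _ ≤ M * ‖g c‖ := by gcongr
    · rwa [closure_ball c one_ne_zero]
  have hgc : ∀ (Z : Multiset ℂ) (g : ℂ → ℂ), (∀ z, f z = (Z.map fun ρ ↦ z - ρ).prod * g z) →
      0 < ‖g c‖ := by
    intro Z g h
    rw [norm_pos_iff]
    rintro h0
    exact hc (by rw [h c, h0, mul_zero])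
  obtain ⟨N, hN⟩ := pow_unbounded_of_one_lt (M / ‖f c‖) (one_lt_two (α := ℝ))
  have hlt : ∀ n, P n → n ≤ N := by
    rintro n ⟨Z, g, rfl, hg, hfg, hZ⟩
    have h1 := hbound Z g hg hfg hZ c (Metric.mem_closedBall_self zero_le_one)
    have h2 := le_of_mul_le_mul_right h1 (hgc Z g hfg)
    exact ((pow_lt_pow_iff_right₀ (one_lt_two (α := ℝ))).mp (h2.trans_lt hN)).le
  have hP0 : P 0 := ⟨0, f, by simp, hf, by simp, by simp⟩
  classical
  obtain ⟨Z, g, hcard, hg, hfg, hZ⟩ := Nat.findGreatest_spec (P := P) (Nat.zero_le N) hP0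
  refine ⟨Z, g, hg, hfg, hZ, fun a ha hga ↦ ?_, fun z hz ↦ ?_⟩
  · have hsucc : P (Nat.findGreatest P N + 1) := by
      refine ⟨a ::ₘ Z, dslope g a, by simp [hcard], fun z ↦ ?_, fun z ↦ ?_, ?_⟩
      · have := (Complex.differentiableOn_dslope (Filter.univ_mem : _ ∈ nhds a)).mpr
          hg.differentiableOn
        exact (this z (Set.mem_univ z)).differentiableAt Filter.univ_mem
      · rw [Multiset.map_cons, Multiset.prod_cons, hfg z, mul_comm (z - a), mul_assoc]
        congr 1
        have := sub_smul_dslope g a z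
        rw [hga, sub_zero, smul_eq_mul] at this
        exact this.symm
      · exact Multiset.forall_mem_cons.mpr ⟨ha, hZ⟩
    have := Nat.le_findGreatest (hlt _ hsucc) hsucc
    omega
  · refine le_trans ?_ (hbound Z g hg hfg hZ z hz)
    exact le_mul_of_one_le_left (norm_nonneg _) (one_le_pow₀ one_le_two)

open Metric in
lemma Complex.norm_logDeriv_le_of_bound {g : ℂ → ℂ} (hg : Differentiable ℂ g) {c : ℂ} {K : ℝ}
    (hK : 1 < K) (h0 : ∀ z ∈ closedBall c (1 / 3), g z ≠ 0)
    (hb : ∀ z ∈ closedBall c 1, ‖g z‖ ≤ K * ‖g c‖) {z : ℂ} (hz : z ∈ closedBall c (1 / 4)) :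
    ‖logDeriv g z‖ ≤ 336 * Real.log K := by
  have hlog : 0 < Real.log K := Real.log_pos hK
  have hd : DifferentiableOn ℂ (logDeriv g) (ball c (1 / 3)) := fun w hw ↦
    ((hg.analyticAt w).deriv.differentiableAt.div (hg w)
      (h0 w (ball_subset_closedBall hw))).differentiableWithinAt
  obtain ⟨l, hlc, hl⟩ := hd.isExactOn_ball.with_val_at c 0
  have hc : c ∈ ball c (1 / 3 : ℝ) := mem_ball_self (by norm_num)
  have hexp : ∀ w ∈ ball c (1 / 3 : ℝ), g w = g c * Complex.exp (l w) := by
    have hconst : ∀ w ∈ ball c (1 / 3 : ℝ), g w * Complex.exp (-l w) = g c * Complex.exp (-l c) := by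
      intro w hw
      refine (convex_ball c (1 / 3 : ℝ)).is_const_of_fderivWithin_eq_zero (𝕜 := ℂ)
        (f := fun w ↦ g w * Complex.exp (-l w)) ?_ ?_ hw hc
      · exact fun x hx ↦ ((hg x).mul (hl x hx).differentiableAt.neg.cexp).differentiableWithinAt
      · intro x hx
        rw [fderivWithin_of_isOpen isOpen_ball hx]
        have h1 := ((hg x).hasDerivAt.mul (hl x hx).neg.cexp)
        have h2 : deriv g x * Complex.exp (-l x) + g x * (Complex.exp (-l x) * -logDeriv g x) = 0 := by
          have := h0 x (ball_subset_closedBall hx)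
          rw [logDeriv_apply]
          field_simp
          ring
        have h3 := h1.hasFDerivAt.fderiv
        simp only [Pi.neg_apply, h2] at h3
        refine Eq.trans h3 ?_
        ext
        simp
    intro w hw
    have := hconst w hw
    rw [hlc, neg_zero, Complex.exp_zero, mul_one] at this
    rw [← this, mul_assoc, ← Complex.exp_add, neg_add_cancel, Complex.exp_zero, mul_one]
  have hre : ∀ w ∈ ball c (1 / 3 : ℝ), (l w).re ≤ Real.log K := by
    intro w hw
    have h1 := hb w (closedBall_subset_closedBall (by norm_num) (ball_subset_closedBall hw))
    rw [hexp w hw, norm_mul, mul_comm, Complex.norm_exp] at h1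
    have h2 := le_of_mul_le_mul_right h1 (norm_pos_iff.mpr (h0 c (ball_subset_closedBall hc)))
    rwa [Real.le_log_iff_exp_le (by linarith)]
  have hBC : ∀ w ∈ closedBall c (7 / 24 : ℝ), ‖l w‖ ≤ 14 * Real.log K := by
    intro w hw
    rw [mem_closedBall, dist_eq_norm] at hw
    have h1 := Complex.borelCaratheodory_zero (f := fun u ↦ l (c + u)) (R := 1 / 3)
      (z := w - c) hlog ?_ ?_ (by norm_num) (by rw [mem_ball_zero_iff]; linarith) (by simpa using hlc)
    · simp only [add_sub_cancel] at h1
      refine h1.trans ?_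
      rw [div_le_iff₀ (by linarith)]
      nlinarith
    · intro u hu
      have : c + u ∈ ball c (1 / 3 : ℝ) := by simpa using hu
      exact ((hl _ this).differentiableAt.comp u
        (by fun_prop : DifferentiableAt ℂ (fun u ↦ c + u) u)).differentiableWithinAt
    · intro u hu
      exact hre _ (by simpa using hu)
  have hsub : closedBall z (1 / 24 : ℝ) ⊆ closedBall c (7 / 24 : ℝ) :=
    closedBall_subset_closedBall' (by rw [mem_closedBall] at hz; linarith)
  have hsub' : closedBall z (1 / 24 : ℝ) ⊆ ball c (1 / 3 : ℝ) :=
    hsub.trans (closedBall_subset_ball (by norm_num))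
  have hzb := hsub' (mem_closedBall_self (by norm_num))
  rw [← (hl z hzb).deriv]
  have := Complex.norm_deriv_le_of_forall_mem_sphere_norm_le (c := z) (R := 1 / 24) (f := l)
    (C := 14 * Real.log K) (by norm_num) ?_
    fun w hw ↦ hBC w (hsub (sphere_subset_closedBall hw))
  · refine this.trans (le_of_eq ?_)
    ring
  · refine DifferentiableOn.diffContOnCl fun w hw ↦ ?_
    rw [closure_ball z (by norm_num)] at hw
    exact (hl w (hsub' hw)).differentiableAt.differentiableWithinAt

lemma Complex.differentiable_multiset_prod_sub (Z : Multiset ℂ) :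
    Differentiable ℂ fun z ↦ (Z.map fun ρ ↦ z - ρ).prod := by
  induction Z using Multiset.induction_on with
  | empty => simp
  | cons a Z ih =>
    simp only [Multiset.map_cons, Multiset.prod_cons]
    fun_prop

lemma Complex.re_logDeriv_multiset_prod_nonneg {Z : Multiset ℂ} {z : ℂ} (h : ∀ ρ ∈ Z, ρ ≠ z)
    (hre : ∀ ρ ∈ Z, ρ.re ≤ z.re) :
    0 ≤ (logDeriv (fun z ↦ (Z.map fun ρ ↦ z - ρ).prod) z).re ∧
      ∀ ρ ∈ Z, (1 / (z - ρ)).re ≤ (logDeriv (fun z ↦ (Z.map fun ρ ↦ z - ρ).prod) z).re := by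
  induction Z using Multiset.induction_on with
  | empty => simp [logDeriv_apply]
  | cons a Z ih =>
    obtain ⟨ih1, ih2⟩ := ih (fun ρ hρ ↦ h ρ (Multiset.mem_cons_of_mem hρ))
      (fun ρ hρ ↦ hre ρ (Multiset.mem_cons_of_mem hρ))
    have ha : z - a ≠ 0 := sub_ne_zero.mpr (h a (Multiset.mem_cons_self a Z)).symm
    have hne : (Z.map fun ρ ↦ z - ρ).prod ≠ 0 := by
      refine Multiset.prod_ne_zero fun h0 ↦ ?_
      obtain ⟨ρ, hρ, h1⟩ := Multiset.mem_map.mp h0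
      exact h ρ (Multiset.mem_cons_of_mem hρ) (sub_eq_zero.mp h1).symm
    have hpos : 0 ≤ (1 / (z - a)).re := by
      rw [one_div, Complex.inv_re]
      exact div_nonneg (by simpa using hre a (Multiset.mem_cons_self a Z)) (Complex.normSq_nonneg _)
    have key : logDeriv (fun z ↦ ((a ::ₘ Z).map fun ρ ↦ z - ρ).prod) z =
        1 / (z - a) + logDeriv (fun z ↦ (Z.map fun ρ ↦ z - ρ).prod) z := by
      simp only [Multiset.map_cons, Multiset.prod_cons]
      rw [logDeriv_mul z ha hne (by fun_prop) (Complex.differentiable_multiset_prod_sub Z).differentiableAt]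
      congr 1
      simp [logDeriv_apply]
    rw [key, Complex.add_re]
    refine ⟨by positivity, fun ρ hρ ↦ ?_⟩
    rcases Multiset.mem_cons.mp hρ with rfl | hρ
    · linarith
    · linarith [ih2 ρ hρ]

/-- A local lower bound for the real part of `f' / f`, to the right of the zeros of `f`. -/
lemma Complex.le_re_logDeriv_of_bound {f : ℂ → ℂ} (hf : Differentiable ℂ f) {c : ℂ} {M K : ℝ}
    (hc : f c ≠ 0) (hM : ∀ z ∈ Metric.closedBall c 1, ‖f z‖ ≤ M) (hK : 1 < K)
    (hMK : M ≤ K * ‖f c‖) {z : ℂ} (hz : z ∈ Metric.closedBall c (1 / 4))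
    (hre : ∀ ρ ∈ Metric.closedBall c (1 / 3), f ρ = 0 → ρ.re ≤ z.re) (hfz : f z ≠ 0) :
    -(336 * Real.log K) ≤ (logDeriv f z).re ∧
    ∀ ρ ∈ Metric.closedBall c (1 / 3), f ρ = 0 →
      (1 / (z - ρ)).re - 336 * Real.log K ≤ (logDeriv f z).re := by
  obtain ⟨Z, g, hg, hfg, hZ, hg0, hgb⟩ := Complex.exists_multiset_prod_mul_of_bound hf hc hM
  have hfc : 0 < ‖f c‖ := norm_pos_iff.mpr hc
  have hroot : ∀ ρ ∈ Z, f ρ = 0 := by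
    intro ρ hρ
    rw [hfg ρ, Multiset.prod_eq_zero, zero_mul]
    exact Multiset.mem_map.mpr ⟨ρ, hρ, sub_self ρ⟩
  have hgz := Complex.norm_logDeriv_le_of_bound hg hK hg0 (fun w hw ↦ (hgb w hw).trans
    (by gcongr; rwa [div_le_iff₀ hfc])) hz
  have hfz' := hfz
  rw [hfg z] at hfz'
  obtain ⟨h1, h2⟩ := Complex.re_logDeriv_multiset_prod_nonneg (Z := Z) (z := z)
    (fun ρ hρ h ↦ hfz (h ▸ hroot ρ hρ)) (fun ρ hρ ↦ hre ρ (hZ ρ hρ) (hroot ρ hρ))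
  have key : logDeriv f z = logDeriv (fun z ↦ (Z.map fun ρ ↦ z - ρ).prod) z + logDeriv g z := by
    rw [← logDeriv_mul z (left_ne_zero_of_mul hfz') (right_ne_zero_of_mul hfz')
      (Complex.differentiable_multiset_prod_sub Z).differentiableAt hg.differentiableAt]
    congr 1
    exact funext hfg
  have h3 := (abs_le.mp ((Complex.abs_re_le_norm _).trans hgz)).1
  rw [key, Complex.add_re]
  refine ⟨by linarith, fun ρ hρ hfρ ↦ ?_⟩
  have hρZ : ρ ∈ Z := by
    rw [hfg ρ] at hfρ
    have := (mul_eq_zero.mp hfρ).resolve_right (hg0 ρ hρ)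
    obtain ⟨a, ha, h4⟩ := Multiset.mem_map.mp (Multiset.prod_eq_zero_iff.mp this)
    rwa [sub_eq_zero.mp h4]
  linarith [h2 ρ hρZ]

open ArithmeticFunction in
lemma hasSum_vonMangoldt_mul_cpow {s : ℂ} (hs : 1 < s.re) :
    HasSum (fun n : ℕ ↦ (vonMangoldt n : ℂ) * (n : ℂ) ^ (-s)) (-logDeriv riemannZeta s) := by
  have h := (LSeriesSummable_vonMangoldt hs).LSeriesHasSum
  rw [LSeries_vonMangoldt_eq_deriv_riemannZeta_div hs, LSeriesHasSum] at h
  rw [logDeriv_apply, ← neg_div]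
  refine h.congr_fun fun n ↦ ?_
  rcases eq_or_ne n 0 with rfl | hn
  · simp
  · rw [LSeries.term_of_ne_zero hn, Complex.cpow_neg, div_eq_mul_inv]

lemma Complex.natCast_cpow_neg_add_mul_I_re (n : ℕ) (hn : n ≠ 0) (x t : ℝ) :
    ((n : ℂ) ^ (-(x + t * I : ℂ))).re = (n : ℝ) ^ (-x) * Real.cos (t * Real.log n) := by
  have h : (n : ℂ) ^ (-(x + t * I : ℂ)) = ((n : ℝ) ^ (-x) : ℝ) * exp ((-(t * Real.log n) : ℝ) * I) := by
    have hn' : (n : ℂ) ≠ 0 := Nat.cast_ne_zero.mpr hn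
    rw [neg_add, cpow_add _ _ hn', ofReal_cpow n.cast_nonneg, cpow_def_of_ne_zero hn' (-(t * I)),
      ← natCast_log]
    push_cast
    ring_nf
  rw [h, re_ofReal_mul, exp_ofReal_mul_I_re, Real.cos_neg]

open ArithmeticFunction in
lemma hasSum_vonMangoldt_mul_rpow_mul_cos {x : ℝ} (hx : 1 < x) (t : ℝ) :
    HasSum (fun n : ℕ ↦ vonMangoldt n * ((n : ℝ) ^ (-x) * Real.cos (t * Real.log n)))
      (-(logDeriv riemannZeta (x + t * Complex.I)).re) := by
  have h := Complex.hasSum_re (hasSum_vonMangoldt_mul_cpow (s := x + t * Complex.I) (by simpa))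
  rw [Complex.neg_re] at h
  refine h.congr_fun fun n ↦ ?_
  rcases eq_or_ne n 0 with rfl | hn
  · simp
  · rw [Complex.re_ofReal_mul, Complex.natCast_cpow_neg_add_mul_I_re n hn]

open ArithmeticFunction in
lemma norm_logDeriv_riemannZeta_le {s : ℂ} (hs : 1 < s.re) :
    ‖logDeriv riemannZeta s‖ ≤ -(logDeriv riemannZeta s.re).re := by
  have h1 := hasSum_vonMangoldt_mul_cpow hs
  have h2 := hasSum_vonMangoldt_mul_rpow_mul_cos hs 0
  simp only [zero_mul, Real.cos_zero, mul_one, Complex.ofReal_zero, add_zero] at h2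
  rw [← norm_neg, ← h1.tsum_eq]
  refine tsum_of_norm_bounded h2 fun n ↦ ?_
  rcases eq_or_ne n 0 with rfl | hn
  · simp
  · rw [norm_mul, Complex.norm_natCast_cpow_of_pos (Nat.pos_of_ne_zero hn), Complex.norm_real,
      Real.norm_of_nonneg vonMangoldt_nonneg, Complex.neg_re]

open ArithmeticFunction in
lemma re_logDeriv_riemannZeta_comb_nonpos {x : ℝ} (hx : 1 < x) (t : ℝ) :
    3 * (logDeriv riemannZeta x).re + 4 * (logDeriv riemannZeta (x + t * Complex.I)).re +
      (logDeriv riemannZeta (x + (2 * t : ℝ) * Complex.I)).re ≤ 0 := by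
  have h0 := hasSum_vonMangoldt_mul_rpow_mul_cos hx 0
  have h := ((h0.mul_left 3).add ((hasSum_vonMangoldt_mul_rpow_mul_cos hx t).mul_left 4)).add
    (hasSum_vonMangoldt_mul_rpow_mul_cos hx (2 * t))
  have := h.nonneg fun n ↦ ?_
  · simp only [Complex.ofReal_zero, zero_mul, add_zero] at this
    linarith
  · have h1 : 0 ≤ vonMangoldt n * (n : ℝ) ^ (-x) :=
      mul_nonneg vonMangoldt_nonneg (Real.rpow_nonneg n.cast_nonneg _)
    rw [zero_mul, Real.cos_zero, mul_assoc 2 t, Real.cos_two_mul]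
    nlinarith [mul_nonneg h1 (sq_nonneg (1 + Real.cos (t * Real.log n)))]

lemma logDeriv_riemannZeta_eq {s : ℂ} (hs : s ≠ 1) (h0 : riemannZeta s ≠ 0) :
    logDeriv riemannZeta s = logDeriv riemannZeta₁ s - 1 / (s - 1) := by
  have hs1 := sub_ne_zero.mpr hs
  have heq : riemannZeta₁ =ᶠ[nhds s] fun z ↦ (z - 1) * riemannZeta z := by
    filter_upwards [isOpen_compl_singleton.mem_nhds hs] with z hz
    have : z - 1 ≠ 0 := sub_ne_zero.mpr hz
    rw [riemannZeta_eq_inv_sub_mul hz]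
    field_simp
  have h2 : logDeriv (fun z : ℂ ↦ z - 1) s = 1 / (s - 1) := by simp [logDeriv_apply]
  rw [(logDeriv_congr_nhds heq).eq_of_nhds, logDeriv_mul s hs1 h0 (by fun_prop)
    (differentiableAt_riemannZeta hs), h2, add_sub_cancel_left]

lemma exists_neg_re_logDeriv_riemannZeta_le :
    ∃ C : ℝ, 0 < C ∧ ∀ x : ℝ, 1 < x → x ≤ 2 →
      -(logDeriv riemannZeta x).re ≤ 1 / (x - 1) + C := by
  have hne : ∀ x ∈ Set.Icc (1 : ℝ) 2, riemannZeta₁ x ≠ 0 := by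
    intro x hx h
    rcases hx.1.eq_or_lt with rfl | hx1
    · simp at h
    · have h1 : (x : ℂ) ≠ 1 := by exact_mod_cast hx1.ne'
      exact riemannZeta_ne_zero_of_one_le_re (s := x) (by simpa using hx.1)
        (by rw [riemannZeta_eq_inv_sub_mul h1, h, mul_zero])
  have hcont : ContinuousOn (fun x : ℝ ↦ logDeriv riemannZeta₁ x) (Set.Icc 1 2) := by
    refine ContinuousOn.div ?_ ?_ hne
    · exact ((differentiable_riemannZeta₁.contDiff (n := 1)).continuous_deriv_one.comp
        Complex.continuous_ofReal).continuousOn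
    · exact (differentiable_riemannZeta₁.continuous.comp Complex.continuous_ofReal).continuousOn
  obtain ⟨C, hC⟩ := isCompact_Icc.exists_bound_of_continuousOn hcont
  refine ⟨max C 1, by positivity, fun x hx1 hx2 ↦ ?_⟩
  have h1 : (x : ℂ) ≠ 1 := by exact_mod_cast hx1.ne'
  rw [logDeriv_riemannZeta_eq h1 (riemannZeta_ne_zero_of_one_le_re (by simpa using hx1.le)),
    Complex.sub_re]
  have h2 : (1 / ((x : ℂ) - 1)).re = 1 / (x - 1) := by
    rw [← Complex.ofReal_one, ← Complex.ofReal_sub, ← Complex.ofReal_div, Complex.ofReal_re]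
  have h3 := (abs_le.mp ((Complex.abs_re_le_norm _).trans (hC x ⟨hx1.le, hx2⟩))).1
  rw [h2]
  linarith [le_max_left C 1]

open ArithmeticFunction in
lemma exists_le_norm_riemannZeta {x : ℝ} (hx : 1 < x) :
    ∃ c : ℝ, 0 < c ∧ ∀ s : ℂ, s.re = x → c ≤ ‖riemannZeta s‖ := by
  have hsum : Summable fun n : ℕ ↦ (n : ℝ) ^ (-x) := Real.summable_nat_rpow.mpr (by linarith)
  set S := ∑' n : ℕ, (n : ℝ) ^ (-x) with hS
  have key : ∀ s : ℂ, s.re = x → 1 ≤ ‖riemannZeta s‖ * S := by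
    intro s hs
    have h1 : 1 < s.re := hs ▸ hx
    have h2 := LSeries_one_mul_Lseries_moebius h1
    rw [LSeries_one_eq_riemannZeta h1] at h2
    rw [← norm_one (α := ℂ), ← h2, norm_mul]
    gcongr
    refine tsum_of_norm_bounded hsum.hasSum fun n ↦ ?_
    rcases eq_or_ne n 0 with rfl | hn
    · simpa using Real.rpow_nonneg le_rfl _
    · rw [LSeries.norm_term_eq, if_neg hn, hs, Real.rpow_neg n.cast_nonneg, ← one_div]
      gcongr
      rw [Complex.norm_intCast]
      exact_mod_cast abs_moebius_le_one
  have hSpos : 0 < S := by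
    have h1 := key x (by simp)
    by_contra! h
    nlinarith [mul_nonneg (norm_nonneg (riemannZeta x)) (neg_nonneg.mpr h)]
  exact ⟨1 / S, by positivity, fun s hs ↦ (div_le_iff₀ hSpos).mpr (key s hs)⟩

lemma one_le_log_abs_add_four (t : ℝ) : 1 ≤ Real.log (|t| + 4) := by
  rw [Real.le_log_iff_exp_le (by positivity)]
  linarith [Real.exp_one_lt_three, abs_nonneg t]

lemma log_abs_add_four_le_two_mul {t u : ℝ} (h : |u| ≤ |t| + 1 ∨ |u| ≤ 2 * |t|) :
    Real.log (|u| + 4) ≤ 2 * Real.log (|t| + 4) := by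
  have ht := abs_nonneg t
  have : Real.log ((|t| + 4) ^ 2) = 2 * Real.log (|t| + 4) := by
    rw [Real.log_pow]; norm_num
  rw [← this]
  apply Real.log_le_log (by positivity)
  rcases h with h | h <;> nlinarith

lemma log_abs_add_four_le_three_mul {t : ℝ} (h : 2 ≤ |t|) :
    Real.log (|t| + 4) ≤ 3 * Real.log |t| := by
  have : Real.log (|t| ^ 3) = 3 * Real.log |t| := by
    rw [Real.log_pow]; norm_num
  rw [← this]
  apply Real.log_le_log (by positivity)
  nlinarith [mul_nonneg (sub_nonneg.2 h) (sub_nonneg.2 h),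
    mul_nonneg (abs_nonneg t) (sub_nonneg.2 h)]

lemma riemannZeta₁_eq_mul {s : ℂ} (hs : s ≠ 1) :
    riemannZeta₁ s = (s - 1) * riemannZeta s := by
  rw [riemannZeta_eq_inv_sub_mul hs, mul_inv_cancel_left₀ (sub_ne_zero.mpr hs)]

lemma riemannZeta₁_ne_zero_of_one_le_re {s : ℂ} (hs : 1 ≤ s.re) : riemannZeta₁ s ≠ 0 := by
  rcases eq_or_ne s 1 with rfl | h
  · simp [riemannZeta₁_one]
  · rw [riemannZeta₁_eq_mul h]
    exact mul_ne_zero (sub_ne_zero.mpr h) (riemannZeta_ne_zero_of_one_le_re hs)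

lemma norm_one_div_sub_one_le {s : ℂ} (hs : 1 ≤ |s.im|) : ‖1 / (s - 1)‖ ≤ 1 := by
  have h : 1 ≤ ‖s - 1‖ := hs.trans (by simpa using Complex.abs_im_le_norm (s - 1))
  rw [norm_div, norm_one]
  exact (div_le_one (by linarith)).mpr h

lemma exists_le_re_logDeriv_riemannZeta₁ :
    ∃ C : ℝ, 0 < C ∧ ∀ z : ℂ, 7 / 8 ≤ z.re → z.re ≤ 11 / 8 → riemannZeta₁ z ≠ 0 →
      (∀ ρ : ℂ, riemannZeta₁ ρ = 0 → |ρ.im - z.im| ≤ 1 / 3 → ρ.re ≤ z.re) →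
      -(C * Real.log (|z.im| + 4)) ≤ (logDeriv riemannZeta₁ z).re ∧
      ∀ ρ : ℂ, riemannZeta₁ ρ = 0 → |ρ.re - 9 / 8| ≤ 1 / 3 → ρ.im = z.im →
        1 / (z.re - ρ.re) - C * Real.log (|z.im| + 4) ≤ (logDeriv riemannZeta₁ z).re := by
  obtain ⟨c₀, hc₀, hlow⟩ := exists_le_norm_riemannZeta (x := 9 / 8) (by norm_num)
  have hlog : 0 < Real.log (1 + 72 / c₀) :=
    Real.log_pos (by linarith [div_pos (by norm_num : (0 : ℝ) < 72) hc₀])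
  refine ⟨336 * (Real.log (1 + 72 / c₀) + 2), by positivity, fun z h1 h2 hz hre ↦ ?_⟩
  set T := |z.im| + 4 with hT
  have hT4 : 4 ≤ T := by linarith [abs_nonneg z.im]
  have hL : 1 ≤ Real.log T := one_le_log_abs_add_four z.im
  set c : ℂ := ⟨9 / 8, z.im⟩ with hc
  have hcre : c.re = 9 / 8 := rfl
  have hcim : c.im = z.im := rfl
  have hc1 : c ≠ 1 := fun h ↦ by
    have := congrArg Complex.re h
    norm_num [hcre] at this
  have hcn : c₀ / 8 ≤ ‖riemannZeta₁ c‖ := by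
    rw [riemannZeta₁_eq_mul hc1, norm_mul]
    have h8 : 1 / 8 ≤ ‖c - 1‖ := by
      have := Complex.re_le_norm (c - 1)
      rw [Complex.sub_re, hcre, Complex.one_re] at this
      linarith
    calc c₀ / 8 = 1 / 8 * c₀ := by ring
      _ ≤ _ := by gcongr; exact hlow c hcre
  have hM : ∀ w ∈ Metric.closedBall c 1, ‖riemannZeta₁ w‖ ≤ 9 * T ^ 2 := by
    intro w hw
    rw [mem_closedBall_iff_norm] at hw
    have hre' := (Complex.abs_re_le_norm _).trans hw
    have him' := (Complex.abs_im_le_norm _).trans hw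
    rw [Complex.sub_re, hcre, abs_le] at hre'
    rw [Complex.sub_im, hcim] at him'
    have him2 : |w.im| ≤ |z.im| + 1 := by
      linarith [abs_sub_abs_le_abs_sub w.im z.im]
    have hw0 : 1 / 8 ≤ w.re := by linarith
    have hn : ‖w‖ ≤ T := by
      refine (Complex.norm_le_abs_re_add_abs_im w).trans ?_
      rw [abs_of_nonneg (by linarith : 0 ≤ w.re)]
      linarith
    have hn1 : ‖w - 1‖ ≤ T := by
      refine (Complex.norm_le_abs_re_add_abs_im _).trans ?_
      have : |w.re - 1| ≤ 2 := abs_le.mpr ⟨by linarith, by linarith⟩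
      simp only [Complex.sub_re, Complex.one_re, Complex.sub_im, Complex.one_im, sub_zero]
      linarith
    calc ‖riemannZeta₁ w‖ ≤ ‖w‖ + ‖w‖ * ‖w - 1‖ / w.re := norm_riemannZeta₁_le (by linarith)
      _ ≤ T + T * T / (1 / 8) := by gcongr
      _ ≤ 9 * T ^ 2 := by nlinarith
  set K := (1 + 72 / c₀) * T ^ 2 with hK
  have hK1 : 1 < K := by
    have : 0 < 72 / c₀ := by positivity
    nlinarith
  have hMK : 9 * T ^ 2 ≤ K * ‖riemannZeta₁ c‖ := by
    calc 9 * T ^ 2 = (72 / c₀) * T ^ 2 * (c₀ / 8) := by field_simp; norm_num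
      _ ≤ K * ‖riemannZeta₁ c‖ := by gcongr; rw [hK]; gcongr; linarith
  have hlogK : 336 * Real.log K ≤ 336 * (Real.log (1 + 72 / c₀) + 2) * Real.log T := by
    rw [hK, Real.log_mul (by positivity) (by positivity), Real.log_pow]
    push_cast
    nlinarith
  have hdist (w : ℂ) (h : w.im = z.im) : dist w c = |w.re - 9 / 8| := by
    have : w - c = ((w.re - 9 / 8 : ℝ) : ℂ) := by
      apply Complex.ext <;> simp [hcre, hcim, h]
    rw [dist_eq_norm, this, Complex.norm_real, Real.norm_eq_abs]
  obtain ⟨hA, hB⟩ := Complex.le_re_logDeriv_of_bound differentiable_riemannZeta₁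
    (norm_pos_iff.mp (lt_of_lt_of_le (by positivity) hcn)) hM hK1 hMK (z := z)
    (by rw [Metric.mem_closedBall, hdist z rfl, abs_le]; constructor <;> linarith)
    (fun ρ hρ h0 ↦ hre ρ h0 (by
      rw [mem_closedBall_iff_norm] at hρ
      exact (Complex.abs_im_le_norm (ρ - c)).trans hρ)) hz
  refine ⟨by linarith, fun ρ h0 h3 him ↦ ?_⟩
  have := hB ρ (by rw [Metric.mem_closedBall, hdist ρ him]; exact h3) h0
  have h5 : 1 / (z - ρ) = ((1 / (z.re - ρ.re) : ℝ) : ℂ) := by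
    have : z - ρ = ((z.re - ρ.re : ℝ) : ℂ) := by
      apply Complex.ext <;> simp [him]
    rw [this]
    push_cast
    rfl
  rw [h5, Complex.ofReal_re] at this
  linarith

lemma exists_re_lt_of_riemannZeta₁_eq_zero :
    ∃ A : ℝ, 0 < A ∧ ∀ ρ : ℂ, 1 ≤ |ρ.im| → riemannZeta₁ ρ = 0 →
      ρ.re < 1 - A / Real.log (|ρ.im| + 4) := by
  obtain ⟨C₁, hC₁, h₁⟩ := exists_le_re_logDeriv_riemannZeta₁
  obtain ⟨C₃, hC₃, h₃⟩ := exists_neg_re_logDeriv_riemannZeta_le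
  set B := 3 * C₃ + 6 * C₁ + 5 with hB
  have hB5 : 5 < B := by linarith
  refine ⟨1 / (15 * B), by positivity, fun ρ him h0 ↦ ?_⟩
  set t := ρ.im with ht
  set L := Real.log (|t| + 4) with hL
  have hL1 : 1 ≤ L := one_le_log_abs_add_four t
  have hBL : 5 < B * L := by nlinarith
  have hzero {w : ℂ} (hw : riemannZeta₁ w = 0) : w.re < 1 := by
    by_contra! h
    exact riemannZeta₁_ne_zero_of_one_le_re h hw
  have hsmall : 1 / (15 * B) / L < 1 / 75 := by
    rw [div_div, div_lt_div_iff₀ (by positivity) (by norm_num)]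
    linarith
  rcases lt_or_ge ρ.re (19 / 24) with hβ | hβ
  · linarith
  set x : ℝ := 1 + 1 / (2 * B * L) with hx
  have hx1 : 1 < x := by
    have : 0 < 1 / (2 * B * L) := by positivity
    linarith
  have hx2 : x ≤ 11 / 10 := by
    have : 1 / (2 * B * L) ≤ 1 / 10 := by
      apply one_div_le_one_div_of_le <;> linarith
    linarith
  have hbound (u : ℝ) (hu : 1 ≤ |u|) :
      (logDeriv riemannZeta₁ (x + u * Complex.I)).re - 1 ≤
        (logDeriv riemannZeta (x + u * Complex.I)).re := by
    have hne : (x + u * Complex.I : ℂ) ≠ 1 := fun h ↦ by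
      have := congrArg Complex.re h
      simp at this
      linarith
    have hre1 : 1 ≤ (x + u * Complex.I : ℂ).re := by simpa using hx1.le
    rw [logDeriv_riemannZeta_eq hne (riemannZeta_ne_zero_of_one_le_re hre1), Complex.sub_re]
    have := (Complex.re_le_norm _).trans
      (norm_one_div_sub_one_le (s := x + u * Complex.I) (by simpa using hu))
    linarith
  have hE (u : ℝ) := h₁ (x + u * Complex.I) (by simp; linarith) (by simp; linarith)
    (riemannZeta₁_ne_zero_of_one_le_re (by simpa using hx1.le))
    (fun w hw _ ↦ by simpa using ((hzero hw).trans hx1).le)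
  have h341 := re_logDeriv_riemannZeta_comb_nonpos hx1 t
  have ha := h₃ x hx1 (by linarith)
  have hb := (hE t).2 ρ h0 (abs_le.mpr ⟨by linarith, by linarith [hzero h0]⟩) (by simp [ht])
  have hc := (hE (2 * t)).1
  simp only [Complex.add_re, Complex.add_im, Complex.ofReal_re, Complex.ofReal_im, Complex.mul_re,
    Complex.mul_im, Complex.I_re, Complex.I_im, mul_zero, mul_one, sub_zero, add_zero, zero_add] at hb hc
  have hd := hbound t him
  have he := hbound (2 * t) (by rw [abs_mul]; norm_num; linarith)
  have hlog2 : Real.log (|2 * t| + 4) ≤ 2 * L :=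
    log_abs_add_four_le_two_mul (Or.inr (by rw [abs_mul]; norm_num))
  have hx3 : 1 / (x - 1) = 2 * B * L := by
    rw [hx, add_sub_cancel_left, one_div_one_div]
  have hlog3 := mul_le_mul_of_nonneg_left hlog2 hC₁.le
  have hC₃L : C₃ ≤ C₃ * L := le_mul_of_one_le_right hC₃.le hL1
  have hmain : 1 / (x - ρ.re) ≤ 7 / 4 * (B * L) := by
    rw [← hL] at hb
    rw [hx3] at ha
    have hBLe : B * L = 3 * (C₃ * L) + 6 * (C₁ * L) + 5 * L := by rw [hB]; ring
    nlinarith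
  have hpos : 0 < x - ρ.re := by linarith [hzero h0]
  rw [div_le_iff₀ hpos] at hmain
  have hprod : 1 / (2 * B * L) * (B * L) = 1 / 2 := by field_simp
  have hprod2 : 1 / (15 * B) / L * (B * L) = 1 / 15 := by field_simp
  by_contra! hcon
  have : (x - ρ.re) * (B * L) ≤ (1 / (2 * B * L) + 1 / (15 * B) / L) * (B * L) :=
    mul_le_mul_of_nonneg_right (by linarith) (by linarith)
  rw [add_mul (1 / (2 * B * L)), hprod, hprod2] at this
  linarith

lemma exists_riemannZeta_ne_zero_and_norm_logDeriv_le :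
    ∃ A : ℝ, 0 < A ∧ ∃ C : ℝ, 0 < C ∧ ∀ s : ℂ, 2 ≤ |s.im| →
      1 - A / Real.log (|s.im| + 4) ≤ s.re → s.re ≤ 2 →
      riemannZeta s ≠ 0 ∧ ‖logDeriv riemannZeta s‖ ≤ C * Real.log (|s.im| + 4) := by
  obtain ⟨C₁, hC₁, h₁⟩ := exists_le_re_logDeriv_riemannZeta₁
  obtain ⟨C₃, hC₃, h₃⟩ := exists_neg_re_logDeriv_riemannZeta_le
  obtain ⟨A₀, hA₀, h₀⟩ := exists_re_lt_of_riemannZeta₁_eq_zero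
  set A := min (A₀ / 8) (1 / 24) with hA
  have hApos : 0 < A := by positivity
  have hA1 : A ≤ A₀ / 8 := min_le_left _ _
  have hA2 : A ≤ 1 / 24 := min_le_right _ _
  refine ⟨A, hApos, 8 * C₁ + 5 * (1 / A + C₃ + 1) + 1, by positivity, fun s him hlo hhi ↦ ?_⟩
  set t := s.im with ht
  set L := Real.log (|t| + 4) with hL
  have hL1 : 1 ≤ L := one_le_log_abs_add_four t
  set δ := A / L with hδ
  have hδpos : 0 < δ := by positivity
  have hδ2 : δ ≤ 1 / 24 := (div_le_self hApos.le hL1).trans hA2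
  have hδinv : 1 / δ = 1 / A * L := by rw [hδ]; field_simp
  have hzeros : ∀ ρ : ℂ, riemannZeta₁ ρ = 0 → |ρ.im - t| ≤ 1 → ρ.re < 1 - 4 * δ := by
    intro ρ hρ hclose
    have h1 : 1 ≤ |ρ.im| := by
      linarith [abs_sub_abs_le_abs_sub t ρ.im, abs_sub_comm t ρ.im]
    have h2 : |ρ.im| ≤ |t| + 1 := by linarith [abs_sub_abs_le_abs_sub ρ.im t]
    refine (h₀ ρ h1 hρ).trans_le ?_
    have h3 : Real.log (|ρ.im| + 4) ≤ 2 * L := log_abs_add_four_le_two_mul (Or.inl h2)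
    have h4 : 1 ≤ Real.log (|ρ.im| + 4) := one_le_log_abs_add_four _
    have : 4 * δ ≤ A₀ / Real.log (|ρ.im| + 4) := by
      calc 4 * δ = 8 * A / (2 * L) := by rw [hδ]; field_simp; norm_num
        _ ≤ A₀ / (2 * L) := by gcongr; linarith
        _ ≤ _ := by gcongr
    linarith
  have hs1 : s ≠ 1 := fun h ↦ by
    rw [ht, h] at him
    norm_num at him
  have hs0' : riemannZeta₁ s ≠ 0 := fun h ↦ by
    have := hzeros s h (by simp [ht])
    linarith
  have hs0 : riemannZeta s ≠ 0 := fun h ↦ hs0' (by rw [riemannZeta₁_eq_mul hs1, h, mul_zero])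
  have hright : ∀ w : ℂ, 1 + δ ≤ w.re → w.re ≤ 2 →
      ‖logDeriv riemannZeta w‖ ≤ (1 / A + C₃) * L := by
    intro w hw hw2
    refine (norm_logDeriv_riemannZeta_le (by linarith)).trans ?_
    refine (h₃ w.re (by linarith) hw2).trans ?_
    have h5 : 1 / (w.re - 1) ≤ 1 / δ := one_div_le_one_div_of_le hδpos (by linarith)
    nlinarith
  have hA' : 0 < 1 / A := by positivity
  refine ⟨hs0, ?_⟩
  rcases le_or_gt (1 + δ) s.re with hcase | hcase
  · exact (hright s hcase hhi).trans (mul_le_mul_of_nonneg_right (by linarith) (by linarith))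
  set c : ℂ := ⟨1 + δ, t⟩ with hc
  have hcre : c.re = 1 + δ := rfl
  have hcim : c.im = t := rfl
  have hc1 : c ≠ 1 := fun h ↦ by
    have := congrArg Complex.re h
    rw [hcre, Complex.one_re] at this
    linarith
  have hball : ∀ z ∈ Metric.ball (0 : ℂ) (3 * δ), riemannZeta₁ (c + z) ≠ 0 ∧
      -(2 * C₁ * L) ≤ (logDeriv riemannZeta₁ (c + z)).re := by
    intro z hz
    rw [mem_ball_zero_iff] at hz
    have hzre := abs_lt.mp ((Complex.abs_re_le_norm z).trans_lt hz)
    have hzim := (Complex.abs_im_le_norm z).trans_lt hz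
    have hre : (c + z).re = 1 + δ + z.re := by rw [Complex.add_re, hcre]
    have him' : (c + z).im = t + z.im := by rw [Complex.add_im, hcim]
    have hne : riemannZeta₁ (c + z) ≠ 0 := fun h ↦ by
      have := hzeros _ h (by rw [him', add_sub_cancel_left]; linarith)
      linarith
    refine ⟨hne, ?_⟩
    have h6 := (h₁ (c + z) (by linarith) (by linarith) hne (fun ρ hρ hclose ↦ by
      have := hzeros ρ hρ (by
        have e : ρ.im - t = (ρ.im - (c + z).im) + z.im := by rw [him']; ring
        rw [e]
        exact (abs_add_le _ _).trans (by linarith))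
      linarith)).1
    have h7 : Real.log (|(c + z).im| + 4) ≤ 2 * L := log_abs_add_four_le_two_mul (Or.inl (by
      rw [him']; exact (abs_add_le _ _).trans (by linarith)))
    nlinarith
  have hdiff : DifferentiableOn ℂ (fun z ↦ -logDeriv riemannZeta₁ (c + z))
      (Metric.ball 0 (3 * δ)) := by
    intro z hz
    have hd : DifferentiableAt ℂ (logDeriv riemannZeta₁) (c + z) :=
      (differentiable_riemannZeta₁.deriv _).div (differentiable_riemannZeta₁ _) (hball z hz).1
    exact (hd.comp z (by fun_prop)).neg.differentiableWithinAt
  have hmaps : Set.MapsTo (fun z ↦ -logDeriv riemannZeta₁ (c + z)) (Metric.ball 0 (3 * δ))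
      {z | z.re ≤ 2 * C₁ * L} := by
    intro z hz
    have := (hball z hz).2
    simp only [Set.mem_ofPred_eq, Complex.neg_re]
    linarith
  have hsc : ‖s - c‖ ≤ 2 * δ := by
    have : s - c = ((s.re - (1 + δ) : ℝ) : ℂ) := by
      apply Complex.ext <;> simp [hcre, hcim, ht]
    rw [this, Complex.norm_real, Real.norm_eq_abs, abs_le]
    constructor <;> linarith
  have hbc := Complex.borelCaratheodory (by positivity) hdiff hmaps (by positivity)
    (z := s - c) (by rw [mem_ball_zero_iff]; linarith)
  rw [add_sub_cancel, add_zero, norm_neg, norm_neg] at hbc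
  have hcbound : ‖logDeriv riemannZeta₁ c‖ ≤ (1 / A + C₃ + 1) * L := by
    have e : logDeriv riemannZeta₁ c = logDeriv riemannZeta c + 1 / (c - 1) := by
      rw [logDeriv_riemannZeta_eq hc1 (riemannZeta_ne_zero_of_one_le_re (by linarith))]
      ring
    rw [e]
    refine (norm_add_le _ _).trans ?_
    have := hright c le_rfl (by linarith)
    have := norm_one_div_sub_one_le (s := c) (by linarith)
    linarith
  have hfrac1 : 2 * (2 * C₁ * L) * ‖s - c‖ / (3 * δ - ‖s - c‖) ≤ 8 * C₁ * L := by
    rw [div_le_iff₀ (by linarith)]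
    have : 0 < C₁ * L := by positivity
    nlinarith
  have hfrac2 : ‖logDeriv riemannZeta₁ c‖ * (3 * δ + ‖s - c‖) / (3 * δ - ‖s - c‖) ≤
      5 * ‖logDeriv riemannZeta₁ c‖ := by
    rw [div_le_iff₀ (by linarith)]
    have := norm_nonneg (logDeriv riemannZeta₁ c)
    nlinarith
  rw [logDeriv_riemannZeta_eq hs1 hs0]
  refine (norm_sub_le _ _).trans ?_
  have := norm_one_div_sub_one_le (s := s) (by linarith)
  linarith

theorem stmt13 : ∃ A : ℝ, 0 < A ∧ ∃ C : ℝ, ∀ σ t : ℝ, 2 ≤ |t| →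
    1 - A / Real.log |t| ≤ σ → σ ≤ 2 →
    riemannZeta (σ + t * Complex.I) ≠ 0 ∧
    ‖deriv riemannZeta (σ + t * Complex.I) / riemannZeta (σ + t * Complex.I)‖
      ≤ C * Real.log |t| := by
  obtain ⟨A, hA, C, hC, h⟩ := exists_riemannZeta_ne_zero_and_norm_logDeriv_le
  refine ⟨A / 3, by positivity, 3 * C, fun σ t ht hlo hhi ↦ ?_⟩
  have hlog := log_abs_add_four_le_three_mul ht
  have hL1 := one_le_log_abs_add_four t
  have hle : A / 3 / Real.log |t| ≤ A / Real.log (|t| + 4) := by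
    rw [div_div]
    gcongr
  have him : (σ + t * Complex.I : ℂ).im = t := by simp
  have hre : (σ + t * Complex.I : ℂ).re = σ := by simp
  obtain ⟨h0, hb⟩ := h (σ + t * Complex.I) (by rwa [him]) (by rw [him, hre]; linarith)
    (by rwa [hre])
  refine ⟨h0, ?_⟩
  rw [him] at hb
  rw [← logDeriv_apply]
  nlinarith
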